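/- Let G = (V, Σ, P) be a context-free grammar, X ∈ V, and k ≥ 0. For every (G,X)-derivation tree t with dim(t) ≥ l(t) + k + 1, there exist at least 2^{2^k} pairwise distinct (G,X)-derivation trees t′ with π(Y(t′)) = π(Y(t)) and dim(t′) ≤ l(t) + k. -/

import Mathlib

/-- A context-free grammar over variables `V` and terminal alphabet `A`:
a set of productions `X → rhs` with `rhs ∈ (A ⊕ V)*`. -/
structure CFG (V : Type) (A : Type) where
  P : Set (V × List (A ⊕ V))

/-- The list of variable occurrences (in order) in a sentential form. -/
def varsOf {V A : Type} (rhs : List (A ⊕ V)) : List V :=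
  rhs.filterMap Sum.getRight?

/-- Raw derivation trees: each node is labeled by a variable and a right-hand side,
and carries the list of subtrees (one per variable occurrence of the rhs). -/
inductive RawTree (V A : Type) : Type where
  | node (X : V) (rhs : List (A ⊕ V)) (children : List (RawTree V A)) : RawTree V A

namespace RawTree

/-- `IsDTree G X t` : `t` is a `(G,X)`-derivation tree. -/
inductive IsDTree {V A : Type} (G : CFG V A) : V → RawTree V A → Prop where
  | node {X : V} {rhs : List (A ⊕ V)} {children : List (RawTree V A)}
      (hP : (X, rhs) ∈ G.P)
      (hch : List.Forall₂ (IsDTree G) (varsOf rhs) children) :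
      IsDTree G X (RawTree.node X rhs children)

/-- Helper for `yield`: interleave the terminals of a rhs with the yields of the
subtrees (consumed in order, one per variable occurrence). -/
def yieldAux {V A : Type} : List (A ⊕ V) → List (List A) → List A
  | [], _ => []
  | (Sum.inl a) :: rest, ys => a :: yieldAux rest ys
  | (Sum.inr _) :: rest, [] => yieldAux rest []
  | (Sum.inr _) :: rest, y :: ys => y ++ yieldAux rest ys

/-- The yield of a derivation tree. -/
def yield {V A : Type} : RawTree V A → List A
  | .node _ rhs cs => yieldAux rhs (cs.attach.map (fun c => yield c.1))
decreasing_by have := List.sizeOf_lt_of_mem c.2; simp; omega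

/-- The dimension (Horton–Strahler number) of a tree. -/
def dim {V A : Type} : RawTree V A → ℕ
  | .node _ _ cs =>
    let ds := cs.attach.map (fun c => dim c.1)
    if ds.isEmpty then 0
    else
      let d := ds.foldr max 0
      if ds.count d = 1 then d else d + 1
decreasing_by have := List.sizeOf_lt_of_mem c.2; simp; omega

/-- The set of variables occurring as left-hand side of a label of some node of `t`. -/
def lhsVars {V A : Type} [DecidableEq V] : RawTree V A → Finset V
  | .node X _ cs => insert X ((cs.attach.map (fun c => lhsVars c.1)).foldr (· ∪ ·) ∅)
decreasing_by have := List.sizeOf_lt_of_mem c.2; simp; omega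

/-- `l(t)`: the number of distinct variables labelling (as lhs) the nodes of `t`. -/
def numLhsVars {V A : Type} [DecidableEq V] (t : RawTree V A) : ℕ := (lhsVars t).card

end RawTree

open RawTree

/-- The Parikh image of a word. -/
noncomputable def parikh {A : Type} (w : List A) : A →₀ ℕ :=
  (w.map (fun a => Finsupp.single a 1)).sum

/-- The ambiguity of `(G,X)` at a word `w`: the number of `(G,X)`-derivation trees
with yield `w`, as an extended natural number. -/
noncomputable def amb {V A : Type} (G : CFG V A) (X : V) (w : List A) : ℕ∞ :=
  Set.encard {t : RawTree V A | IsDTree G X t ∧ yield t = w}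

/-- The commutative ambiguity of `(G,X)` at a Parikh vector `v`: the number of
`(G,X)`-derivation trees whose yield has Parikh image `v`. -/
noncomputable def camb {V A : Type} (G : CFG V A) (X : V) (v : A →₀ ℕ) : ℕ∞ :=
  Set.encard {t : RawTree V A | IsDTree G X t ∧ parikh (yield t) = v}

/-- One rewriting step of `G` on sentential forms. -/
def Produces {V A : Type} (G : CFG V A) (α β : List (A ⊕ V)) : Prop :=
  ∃ pre post X rhs, (X, rhs) ∈ G.P ∧
    α = pre ++ Sum.inr X :: post ∧ β = pre ++ rhs ++ post

/-- Derivation in one or more steps (`⇒⁺`). -/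
def DerivesPlus {V A : Type} (G : CFG V A) : List (A ⊕ V) → List (A ⊕ V) → Prop :=
  Relation.TransGen (Produces G)

/-- Derivation in zero or more steps (`⇒*`). -/
def Derives {V A : Type} (G : CFG V A) : List (A ⊕ V) → List (A ⊕ V) → Prop :=
  Relation.ReflTransGen (Produces G)

/-- A grammar is nonexpansive if no variable `X` derives a sentential form
containing two or more occurrences of `X`. -/
def Nonexpansive {V A : Type} [DecidableEq V] [DecidableEq A] (G : CFG V A) : Prop :=
  ∀ (X : V) (α : List (A ⊕ V)), DerivesPlus G [Sum.inr X] α → α.count (Sum.inr X) ≤ 1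

namespace RawTree

variable {V A : Type}

@[elab_as_elim]
theorem induction_children {motive : RawTree V A → Prop}
    (node : ∀ X rhs cs, (∀ c ∈ cs, motive c) → motive (.node X rhs cs)) (t : RawTree V A) :
    motive t := by
  induction h : sizeOf t using Nat.strong_induction_on generalizing t with
  | _ n ih =>
    obtain ⟨X, rhs, cs⟩ := t
    refine node X rhs cs fun c hc => ih _ ?_ c rfl
    have := List.sizeOf_lt_of_mem hc
    simp at h
    omega

/-- The multiset of productions labelling the nodes of a tree. -/
def prods : RawTree V A → Multiset (V × List (A ⊕ V))
  | .node X rhs cs => (X, rhs) ::ₘ (cs.attach.map (fun c => prods c.1)).sum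
decreasing_by have := List.sizeOf_lt_of_mem c.2; simp; omega

theorem prods_node (X : V) (rhs : List (A ⊕ V)) (cs : List (RawTree V A)) :
    prods (.node X rhs cs) = (X, rhs) ::ₘ (cs.map prods).sum := by
  rw [prods, List.attach_map_val]

theorem yield_node (X : V) (rhs : List (A ⊕ V)) (cs : List (RawTree V A)) :
    yield (.node X rhs cs) = yieldAux rhs (cs.map yield) := by
  rw [yield, List.attach_map_val]

theorem lhsVars_node [DecidableEq V] (X : V) (rhs : List (A ⊕ V)) (cs : List (RawTree V A)) :
    lhsVars (.node X rhs cs) = insert X ((cs.map lhsVars).foldr (· ∪ ·) ∅) := by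
  rw [lhsVars, List.attach_map_val]

theorem dim_node (X : V) (rhs : List (A ⊕ V)) (cs : List (RawTree V A)) :
    dim (.node X rhs cs) = if cs = [] then 0 else
      if (cs.map dim).count ((cs.map dim).foldr max 0) = 1 then (cs.map dim).foldr max 0
      else (cs.map dim).foldr max 0 + 1 := by
  rw [dim, List.attach_map_val]
  simp

theorem mem_lhsVars_node [DecidableEq V] {Y X : V} {rhs : List (A ⊕ V)}
    {cs : List (RawTree V A)} :
    Y ∈ lhsVars (.node X rhs cs) ↔ Y = X ∨ ∃ c ∈ cs, Y ∈ lhsVars c := by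
  rw [lhsVars_node, Finset.mem_insert]
  refine or_congr_right ?_
  induction cs with
  | nil => simp
  | cons c cs ih => simp [ih]

theorem lhsVars_subset_of_mem [DecidableEq V] {X : V} {rhs : List (A ⊕ V)}
    {cs : List (RawTree V A)} {c : RawTree V A} (hc : c ∈ cs) :
    lhsVars c ⊆ lhsVars (.node X rhs cs) :=
  fun _ hY => mem_lhsVars_node.2 (.inr ⟨c, hc, hY⟩)

theorem mem_prods_node {p : V × List (A ⊕ V)} {X : V} {rhs : List (A ⊕ V)}
    {cs : List (RawTree V A)} :
    p ∈ prods (.node X rhs cs) ↔ p = (X, rhs) ∨ ∃ c ∈ cs, p ∈ prods c := by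
  rw [prods_node, Multiset.mem_cons]
  refine or_congr_right ?_
  induction cs with
  | nil => simp
  | cons c cs ih => simp [ih]

theorem mem_lhsVars_iff [DecidableEq V] {Y : V} {t : RawTree V A} :
    Y ∈ lhsVars t ↔ ∃ p ∈ prods t, p.1 = Y := by
  induction t using induction_children with
  | node X rhs cs ih =>
    simp only [mem_lhsVars_node, mem_prods_node, or_and_right, exists_or, exists_eq_left]
    refine or_congr eq_comm ⟨?_, ?_⟩
    · rintro ⟨c, hc, hY⟩
      obtain ⟨p, hp, rfl⟩ := (ih c hc).1 hY
      exact ⟨p, ⟨c, hc, hp⟩, rfl⟩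
    · rintro ⟨p, ⟨c, hc, hp⟩, rfl⟩
      exact ⟨c, hc, (ih c hc).2 ⟨p, hp, rfl⟩⟩

theorem lhsVars_mono [DecidableEq V] {s t : RawTree V A} (h : ∀ p ∈ prods s, p ∈ prods t) :
    lhsVars s ⊆ lhsVars t := fun _ hY =>
  let ⟨p, hp, hpY⟩ := mem_lhsVars_iff.1 hY
  mem_lhsVars_iff.2 ⟨p, h p hp, hpY⟩

theorem lhsVars_congr [DecidableEq V] {s t : RawTree V A} (h : prods s = prods t) :
    lhsVars s = lhsVars t :=
  (lhsVars_mono (by simp [h])).antisymm (lhsVars_mono (by simp [h]))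

theorem numLhsVars_congr [DecidableEq V] {s t : RawTree V A} (h : prods s = prods t) :
    numLhsVars s = numLhsVars t := by
  rw [numLhsVars, numLhsVars, lhsVars_congr h]

theorem numLhsVars_le_of_mem [DecidableEq V] {X : V} {rhs : List (A ⊕ V)}
    {cs : List (RawTree V A)} {c : RawTree V A} (hc : c ∈ cs) :
    numLhsVars c ≤ numLhsVars (.node X rhs cs) :=
  Finset.card_le_card (lhsVars_subset_of_mem hc)

theorem card_prods_lt_of_mem {X : V} {rhs : List (A ⊕ V)}
    {cs : List (RawTree V A)} {c : RawTree V A} (hc : c ∈ cs) :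
    (prods c).card < (prods (.node X rhs cs)).card := by
  obtain ⟨l, r, rfl⟩ := List.append_of_mem hc
  simp only [prods_node, List.map_append, List.map_cons, List.sum_append, List.sum_cons,
    Multiset.card_cons, Multiset.card_add]
  omega

/-! ### Derivation trees -/

theorem isDTree_node_iff {G : CFG V A} {Y X : V} {rhs : List (A ⊕ V)}
    {cs : List (RawTree V A)} :
    IsDTree G Y (.node X rhs cs) ↔
      Y = X ∧ (X, rhs) ∈ G.P ∧ List.Forall₂ (IsDTree G) (varsOf rhs) cs := by
  constructor
  · rintro ⟨hP, hch⟩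
    exact ⟨rfl, hP, hch⟩
  · rintro ⟨rfl, hP, hch⟩
    exact .node hP hch

theorem _root_.List.forall₂_append_cons_right_iff {α β : Type*} {R : α → β → Prop} {xs : List α}
    {l r : List β} {b : β} :
    List.Forall₂ R xs (l ++ b :: r) ↔
      ∃ x a y, xs = x ++ a :: y ∧ List.Forall₂ R x l ∧ R a b ∧ List.Forall₂ R y r := by
  constructor
  · intro h
    induction l generalizing xs with
    | nil =>
      obtain ⟨a, y, hab, hy, rfl⟩ := List.forall₂_cons_right_iff.1 h
      exact ⟨[], a, y, rfl, .nil, hab, hy⟩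
    | cons c l ih =>
      obtain ⟨a, y, hac, hy, rfl⟩ := List.forall₂_cons_right_iff.1 h
      obtain ⟨x, a', y, rfl, hx, ha', hy⟩ := ih hy
      exact ⟨a :: x, a', y, rfl, .cons hac hx, ha', hy⟩
  · rintro ⟨x, a, y, rfl, hx, ha, hy⟩
    exact List.rel_append hx (.cons ha hy)

theorem _root_.List.Forall₂.exists_left_of_mem {α β : Type*} {R : α → β → Prop} {xs : List α}
    {l : List β} (h : List.Forall₂ R xs l) {b : β} (hb : b ∈ l) : ∃ a, R a b := by
  obtain ⟨l, r, rfl⟩ := List.append_of_mem hb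
  obtain ⟨_, a, _, _, _, ha, _⟩ := List.forall₂_append_cons_right_iff.1 h
  exact ⟨a, ha⟩

theorem parikh_append (u v : List A) : parikh (u ++ v) = parikh u + parikh v := by
  simp [parikh]

theorem parikh_yieldAux (rhs : List (A ⊕ V)) (ys : List (List A))
    (h : (varsOf rhs).length = ys.length) :
    parikh (yieldAux rhs ys) =
      parikh (rhs.filterMap Sum.getLeft?) + (ys.map parikh).sum := by
  induction rhs generalizing ys with
  | nil =>
    obtain rfl : ys = [] := by simpa [varsOf, eq_comm] using h
    simp [yieldAux, parikh]
  | cons x rhs ih =>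
    rcases x with a | v
    · have := ih ys (by simpa [varsOf, List.filterMap_cons] using h)
      simp only [parikh] at this
      simp [yieldAux, parikh, this, add_assoc]
    · rcases ys with _ | ⟨y, ys⟩
      · simp [varsOf] at h
      · have := ih ys (by simpa [varsOf] using h)
        simp only [yieldAux, parikh_append, this, List.map_cons, List.sum_cons]
        simp only [List.filterMap_cons, Sum.getLeft?_inr]
        abel

theorem parikh_yield {G : CFG V A} {X : V} {t : RawTree V A} (ht : IsDTree G X t) :
    parikh (yield t) =
      ((prods t).map fun p => parikh (p.2.filterMap Sum.getLeft?)).sum := by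
  induction t using induction_children generalizing X with
  | node Y rhs cs ih =>
    obtain ⟨rfl, -, hch⟩ := isDTree_node_iff.1 ht
    rw [yield_node, parikh_yieldAux _ _ (by simpa using hch.length_eq), prods_node,
      Multiset.map_cons, Multiset.sum_cons]
    congr 1
    have h : ∀ c ∈ cs, parikh (yield c) =
        ((prods c).map fun p => parikh (p.2.filterMap Sum.getLeft?)).sum := fun c hc =>
      let ⟨_, hZ⟩ := hch.exists_left_of_mem hc
      ih c hc hZ
    clear hch ih ht
    induction cs with
    | nil => simp
    | cons c cs ih =>
      simp only [List.mem_cons, forall_eq_or_imp] at h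
      simp only [List.map_cons, List.sum_cons, Multiset.map_add, Multiset.sum_add, h.1, ih h.2]

/-! ### Dimension of a tree in terms of the dimensions of its children -/

theorem _root_.List.foldr_max_le {l : List ℕ} {n : ℕ} (h : ∀ a ∈ l, a ≤ n) :
    l.foldr max 0 ≤ n := by
  induction l with
  | nil => simp
  | cons a l ih =>
    simp only [List.mem_cons, forall_eq_or_imp] at h
    simpa using ⟨h.1, ih h.2⟩

theorem _root_.List.foldr_max_mem {l : List ℕ} (h : l ≠ []) : l.foldr max 0 ∈ l := by
  induction l with
  | nil => exact absurd rfl h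
  | cons a l ih =>
    rcases eq_or_ne l [] with rfl | hl
    · simp
    · rcases max_choice a (l.foldr max 0) with h | h <;> simp only [List.foldr_cons, h]
      · simp
      · exact List.mem_cons_of_mem _ (ih hl)

theorem dim_node_le_of_forall_lt {X : V} {rhs : List (A ⊕ V)} {cs : List (RawTree V A)} {n : ℕ}
    (h : ∀ c ∈ cs, dim c < n) : dim (.node X rhs cs) ≤ n := by
  rw [dim_node]
  split_ifs with hcs
  · simp
  all_goals
    have := List.foldr_max_mem (l := cs.map dim) (by simpa using hcs)
    obtain ⟨c, hc, hd⟩ := List.mem_map.1 this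
    have := h c hc
    omega

theorem dim_node_le_of_split {X : V} {rhs : List (A ⊕ V)} {l r : List (RawTree V A)}
    {s : RawTree V A} {n : ℕ} (hl : ∀ c ∈ l, dim c < n) (hr : ∀ c ∈ r, dim c < n)
    (hs : dim s ≤ n) : dim (.node X rhs (l ++ s :: r)) ≤ n := by
  have hm : ((l ++ s :: r).map dim).foldr max 0 ≤ n := List.foldr_max_le (by
    simp only [List.mem_map, List.mem_append, List.mem_cons]
    rintro _ ⟨c, hc | rfl | hc, rfl⟩
    exacts [(hl c hc).le, hs, (hr c hc).le])
  rcases hm.lt_or_eq with hm' | hm'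
  · rw [dim_node]
    split_ifs <;> omega
  · rcases hs.lt_or_eq with hs' | hs'
    · refine dim_node_le_of_forall_lt fun c hc => ?_
      simp only [List.mem_append, List.mem_cons] at hc
      rcases hc with hc | rfl | hc
      exacts [hl c hc, hs', hr c hc]
    · have hl0 : (l.map dim).count n = 0 := List.count_eq_zero.2 (by
        rw [List.mem_map]; rintro ⟨c, hc, rfl⟩; exact lt_irrefl _ (hl c hc))
      have hr0 : (r.map dim).count n = 0 := List.count_eq_zero.2 (by
        rw [List.mem_map]; rintro ⟨c, hc, rfl⟩; exact lt_irrefl _ (hr c hc))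
      rw [dim_node, hm', if_neg (by simp), if_pos]
      simp only [List.map_append, List.map_cons, List.count_append, List.count_cons, hl0, hr0, hs']
      simp

theorem exists_two_of_lt_dim_node {X : V} {rhs : List (A ⊕ V)} {cs : List (RawTree V A)} {n : ℕ}
    (h : ∀ c ∈ cs, dim c ≤ n) (hn : n < dim (.node X rhs cs)) :
    ∃ l a m b r, cs = l ++ a :: (m ++ b :: r) ∧ dim a = n ∧ dim b = n := by
  have hm : (cs.map dim).foldr max 0 ≤ n := List.foldr_max_le (by simpa using h)
  rw [dim_node] at hn
  split_ifs at hn with hcs hcount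
  · omega
  · omega
  have hmn : (cs.map dim).foldr max 0 = n := by omega
  have hmem := List.foldr_max_mem (l := cs.map dim) (by simpa using hcs)
  have hpos := List.count_pos_iff.2 hmem
  rw [hmn] at hcount hpos
  have hsub : (List.replicate 2 n).Sublist (cs.map dim) := List.replicate_sublist_iff.2 (by omega)
  obtain ⟨l', hl', hmap⟩ := List.sublist_map_iff.1 hsub
  obtain ⟨a, l', rfl, ha, hmap⟩ := List.map_eq_cons_iff.1 hmap.symm
  obtain ⟨b, l', rfl, hb, hmap⟩ := List.map_eq_cons_iff.1 hmap
  obtain rfl : l' = [] := by simpa using hmap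
  obtain ⟨r₁, r₂, rfl, har, hbr⟩ := List.cons_sublist_iff.1 hl'
  obtain ⟨l, m, rfl⟩ := List.append_of_mem har
  obtain ⟨m', r, rfl⟩ := List.append_of_mem (List.singleton_sublist.1 hbr)
  exact ⟨l, a, m ++ m', b, r, by simp, ha, hb⟩

/-! ### Moving pumps between trees -/

theorem prods_node_split (X : V) (rhs : List (A ⊕ V)) (l r : List (RawTree V A))
    (c : RawTree V A) :
    prods (.node X rhs (l ++ c :: r)) =
      prods c + ((X, rhs) ::ₘ ((l.map prods).sum + (r.map prods).sum)) := by
  rw [prods_node, List.map_append, List.map_cons, List.sum_append, List.sum_cons,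
    Multiset.add_cons, add_left_comm]

theorem IsDTree.exists_replace [DecidableEq V] {G : CFG V A} {X Y : V} {d : RawTree V A}
    (hd : IsDTree G X d) (hY : Y ∈ lhsVars d) :
    ∃ e M, ∃ f : RawTree V A → RawTree V A, IsDTree G Y e ∧ prods d = prods e + M ∧
      ∀ e', IsDTree G Y e' → IsDTree G X (f e') ∧ prods (f e') = prods e' + M := by
  induction d using induction_children generalizing X with
  | node Z rhs cs ih =>
    obtain ⟨rfl, hP, hch⟩ := isDTree_node_iff.1 hd
    rcases mem_lhsVars_node.1 hY with rfl | ⟨c, hc, hYc⟩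
    · exact ⟨_, 0, id, hd, by simp, fun e' he' => ⟨he', by simp⟩⟩
    obtain ⟨l, r, rfl⟩ := List.append_of_mem hc
    obtain ⟨x, W, y, hxy, hl, hcW, hr⟩ := List.forall₂_append_cons_right_iff.1 hch
    obtain ⟨e, M, f, he, hM, hf⟩ := ih c hc hcW hYc
    refine ⟨e, M + ((X, rhs) ::ₘ ((l.map prods).sum + (r.map prods).sum)),
      fun e' => .node X rhs (l ++ f e' :: r), he, ?_, fun e' he' => ⟨?_, ?_⟩⟩
    · rw [prods_node_split, hM, add_assoc]
    · exact .node hP (List.forall₂_append_cons_right_iff.2 ⟨x, W, y, hxy, hl, (hf e' he').1, hr⟩)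
    · rw [prods_node_split, (hf e' he').2, add_assoc]

theorem IsDTree.exists_pump_or_dim_lt [DecidableEq V] {G : CFG V A} {X : V} {c : RawTree V A}
    (hc : IsDTree G X c) :
    (∃ Y ∈ lhsVars c, ∃ c' M, ∃ f : RawTree V A → RawTree V A,
      IsDTree G X c' ∧ M ≠ 0 ∧ prods c = prods c' + M ∧
      ∀ e, IsDTree G Y e → IsDTree G Y (f e) ∧ prods (f e) = prods e + M) ∨
    dim c < numLhsVars c := by
  induction c using induction_children generalizing X with
  | node Z rhs cs ih =>
    obtain ⟨rfl, hP, hch⟩ := isDTree_node_iff.1 hc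
    by_cases hX : ∃ c ∈ cs, X ∈ lhsVars c
    · left
      obtain ⟨c, hcs, hX⟩ := hX
      obtain ⟨l, r, rfl⟩ := List.append_of_mem hcs
      obtain ⟨x, W, y, hxy, hl, hcW, hr⟩ := List.forall₂_append_cons_right_iff.1 hch
      obtain ⟨e, M, f, he, hM, hf⟩ := hcW.exists_replace hX
      refine ⟨X, mem_lhsVars_node.2 (.inl rfl), e,
        M + ((X, rhs) ::ₘ ((l.map prods).sum + (r.map prods).sum)),
        fun e' => .node X rhs (l ++ f e' :: r), he, by simp, ?_, fun e' he' => ⟨?_, ?_⟩⟩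
      · rw [prods_node_split, hM, add_assoc]
      · exact .node hP (List.forall₂_append_cons_right_iff.2 ⟨x, W, y, hxy, hl, (hf e' he').1, hr⟩)
      · rw [prods_node_split, (hf e' he').2, add_assoc]
    by_cases hdim : ∀ c ∈ cs, dim c < numLhsVars c
    · right
      have key : dim (.node X rhs cs) ≤ numLhsVars (.node X rhs cs) - 1 := by
        refine dim_node_le_of_forall_lt fun c hcs => ?_
        have h₁ : lhsVars c ⊂ lhsVars (.node X rhs cs) :=
          (Finset.ssubset_iff_of_subset (lhsVars_subset_of_mem hcs)).2
            ⟨X, mem_lhsVars_node.2 (.inl rfl), fun h => hX ⟨c, hcs, h⟩⟩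
        have h₂ : numLhsVars c < numLhsVars (.node X rhs cs) := Finset.card_lt_card h₁
        have := hdim c hcs
        omega
      have : 0 < numLhsVars (.node X rhs cs) :=
        Finset.card_pos.2 ⟨X, mem_lhsVars_node.2 (.inl rfl)⟩
      omega
    · left
      push Not at hdim
      obtain ⟨c, hcs, hdim⟩ := hdim
      obtain ⟨l, r, rfl⟩ := List.append_of_mem hcs
      obtain ⟨x, W, y, hxy, hl, hcW, hr⟩ := List.forall₂_append_cons_right_iff.1 hch
      obtain ⟨Y, hY, c', M, f, hc', hM0, hM, hf⟩ := (ih c hcs hcW).resolve_right hdim.not_gt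
      refine ⟨Y, lhsVars_subset_of_mem hcs hY, .node X rhs (l ++ c' :: r), M, f,
        .node hP (List.forall₂_append_cons_right_iff.2 ⟨x, W, y, hxy, hl, hc', hr⟩), hM0, ?_, hf⟩
      rw [prods_node_split, prods_node_split, hM, add_right_comm]

theorem IsDTree.exists_shrink [DecidableEq V] {G : CFG V A} {X Y : V} {c s : RawTree V A}
    (hc : IsDTree G X c) (hs : IsDTree G Y s) (hcs : lhsVars c ⊆ lhsVars s) :
    ∃ c' s', IsDTree G X c' ∧ IsDTree G Y s' ∧ prods c' + prods s' = prods c + prods s ∧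
      dim c' < numLhsVars s ∧ (numLhsVars s ≤ dim c → (prods c').card < (prods c).card) ∧
      prods s ≤ prods s' ∧ lhsVars s' = lhsVars s := by
  induction hn : (prods c).card using Nat.strong_induction_on generalizing c s with
  | _ n ih =>
    subst hn
    by_cases hd : dim c < numLhsVars s
    · exact ⟨c, s, hc, hs, rfl, hd, fun h => absurd hd h.not_gt, le_rfl, rfl⟩
    have hle : numLhsVars c ≤ numLhsVars s := Finset.card_le_card hcs
    obtain ⟨Z, hZ, c₁, M, f, hc₁, hM0, hM, hf⟩ := hc.exists_pump_or_dim_lt.resolve_right (by omega)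
    obtain ⟨e, N, g, he, hN, hg⟩ := hs.exists_replace (hcs hZ)
    have hs₁ := (hg _ (hf e he).1).1
    have hprods : prods (g (f e)) = prods s + M := by
      rw [(hg _ (hf e he).1).2, (hf e he).2, hN, add_right_comm]
    have hcard : (prods c₁).card < (prods c).card := by
      have := Multiset.card_pos.2 hM0
      rw [hM, Multiset.card_add]
      omega
    have hvars : lhsVars (g (f e)) = lhsVars s := by
      refine Finset.Subset.antisymm (fun W hW => ?_) (lhsVars_mono fun p hp => ?_)
      · obtain ⟨p, hp, rfl⟩ := mem_lhsVars_iff.1 hW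
        rw [hprods, Multiset.mem_add] at hp
        rcases hp with hp | hp
        · exact mem_lhsVars_iff.2 ⟨p, hp, rfl⟩
        · exact hcs (mem_lhsVars_iff.2 ⟨p, by simp [hM, hp], rfl⟩)
      · simp [hprods, hp]
    have hnum : numLhsVars (g (f e)) = numLhsVars s := congrArg Finset.card hvars
    obtain ⟨c', s', hc', hs', hsum, hdim, -, hle', hvars'⟩ := ih _ hcard hc₁ hs₁
      (hvars ▸ (lhsVars_mono fun p hp => by simp [hM, hp]).trans hcs) rfl
    refine ⟨c', s', hc', hs', ?_, hnum ▸ hdim, fun _ => ?_, ?_, hvars'.trans hvars⟩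
    · rw [hsum, hprods, hM, add_assoc, add_comm M]
    · have h₁ := congrArg Multiset.card hsum
      have h₂ := Multiset.card_le_card hle'
      simp only [Multiset.card_add] at h₁
      omega
    · exact (hprods ▸ Multiset.le_add_right _ _).trans hle'

theorem exists_shrink_list [DecidableEq V] {G : CFG V A} {Ys : List V} {Y : V}
    {cs : List (RawTree V A)} {s : RawTree V A} (hcs : List.Forall₂ (IsDTree G) Ys cs)
    (hs : IsDTree G Y s) (hsub : ∀ c ∈ cs, lhsVars c ⊆ lhsVars s) :
    ∃ cs' s', List.Forall₂ (IsDTree G) Ys cs' ∧ IsDTree G Y s' ∧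
      (cs'.map prods).sum + prods s' = (cs.map prods).sum + prods s ∧
      (∀ c ∈ cs', dim c < numLhsVars s) ∧
      List.Forall₂ (fun c c' => numLhsVars s ≤ dim c → (prods c').card < (prods c).card) cs cs' ∧
      prods s ≤ prods s' ∧ lhsVars s' = lhsVars s := by
  induction hcs generalizing s with
  | nil => exact ⟨[], s, .nil, hs, rfl, by simp, .nil, le_rfl, rfl⟩
  | @cons Z c Zs cs hc hcs ih =>
    simp only [List.mem_cons, forall_eq_or_imp] at hsub
    obtain ⟨c', s₁, hc', hs₁, hsum₁, hdim₁, hlt₁, hle₁, hv₁⟩ := hc.exists_shrink hs hsub.1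
    have hnum : numLhsVars s₁ = numLhsVars s := congrArg Finset.card hv₁
    obtain ⟨cs', s', hcs', hs', hsum, hdim, hlt, hle, hv⟩ := ih hs₁ (by rw [hv₁]; exact hsub.2)
    rw [hnum] at hdim hlt
    refine ⟨c' :: cs', s', .cons hc' hcs', hs', ?_, ?_, .cons hlt₁ hlt, hle₁.trans hle,
      hv.trans hv₁⟩
    · simp only [List.map_cons, List.sum_cons]
      rw [add_assoc, hsum, add_left_comm, hsum₁]
      abel
    · simpa using ⟨hdim₁, hdim⟩

/-! ### Reducing the dimension -/

theorem exists_sink_of_reducible [DecidableEq V] {G : CFG V A} {X Z : V} {rhs : List (A ⊕ V)}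
    {l r : List (RawTree V A)} {s : RawTree V A}
    (ht : IsDTree G Z (.node X rhs (l ++ s :: r)))
    (hs : lhsVars s = lhsVars (.node X rhs (l ++ s :: r)))
    (hred : ∀ W u, IsDTree G W u → (prods u).card < (prods (.node X rhs (l ++ s :: r))).card →
      ∃ u', IsDTree G W u' ∧ prods u' = prods u ∧ dim u' ≤ numLhsVars u) :
    ∃ l' s' r', IsDTree G Z (.node X rhs (l' ++ s' :: r')) ∧
      prods (.node X rhs (l' ++ s' :: r')) = prods (.node X rhs (l ++ s :: r)) ∧
      dim (.node X rhs (l' ++ s' :: r')) ≤ numLhsVars s ∧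
      List.Forall₂ (fun c c' => numLhsVars s ≤ dim c → (prods c').card < (prods c).card) l l' ∧
      List.Forall₂ (fun c c' => numLhsVars s ≤ dim c → (prods c').card < (prods c).card) r r' ∧
      (prods s).card ≤ (prods s').card := by
  obtain ⟨rfl, hP, hch⟩ := isDTree_node_iff.1 ht
  obtain ⟨x, W, y, hxy, hl, hsW, hr⟩ := List.forall₂_append_cons_right_iff.1 hch
  have hsub : ∀ c ∈ l ++ s :: r, lhsVars c ⊆ lhsVars s := fun c hc => hs ▸ lhsVars_subset_of_mem hc
  obtain ⟨l', s₁, hl', hs₁, hsum₁, hdiml, hltl, hle₁, hv₁⟩ :=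
    exists_shrink_list hl hsW fun c hc => hsub c (by simp [hc])
  have hnum₁ : numLhsVars s₁ = numLhsVars s := congrArg Finset.card hv₁
  obtain ⟨r', s₂, hr', hs₂, hsum₂, hdimr, hltr, hle₂, hv₂⟩ :=
    exists_shrink_list hr hs₁ fun c hc => hv₁ ▸ hsub c (by simp [hc])
  have hnum₂ : numLhsVars s₂ = numLhsVars s₁ := congrArg Finset.card hv₂
  have hprods : prods (.node Z rhs (l' ++ s₂ :: r')) = prods (.node Z rhs (l ++ s :: r)) := by
    rw [prods_node_split, prods_node_split, Multiset.add_cons, Multiset.add_cons]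
    congr 1
    calc prods s₂ + ((l'.map prods).sum + (r'.map prods).sum)
        = (l'.map prods).sum + ((r'.map prods).sum + prods s₂) := by abel
      _ = ((l'.map prods).sum + prods s₁) + (r.map prods).sum := by rw [hsum₂]; abel
      _ = prods s + ((l.map prods).sum + (r.map prods).sum) := by rw [hsum₁]; abel
  obtain ⟨s', hs', hps', hds'⟩ := hred W s₂ hs₂ (hprods ▸ card_prods_lt_of_mem (by simp))
  refine ⟨l', s', r', ?_, ?_, ?_, hltl, hnum₁ ▸ hltr, ?_⟩
  · exact .node hP (List.forall₂_append_cons_right_iff.2 ⟨x, W, y, hxy, hl', hs', hr'⟩)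
  · rw [← hprods, prods_node_split, prods_node_split, hps']
  · exact dim_node_le_of_split hdiml (hnum₁ ▸ hdimr) (by omega)
  · rw [hps']
    exact Multiset.card_le_card (hle₁.trans hle₂)

theorem exists_forall₂_of_reducible [DecidableEq V] {G : CFG V A} {Ys : List V}
    {cs : List (RawTree V A)} (hcs : List.Forall₂ (IsDTree G) Ys cs)
    (hred : ∀ c ∈ cs, ∀ W, IsDTree G W c →
      ∃ c', IsDTree G W c' ∧ prods c' = prods c ∧ dim c' ≤ numLhsVars c) :
    ∃ cs', List.Forall₂ (IsDTree G) Ys cs' ∧ cs'.map prods = cs.map prods ∧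
      ∀ c' ∈ cs', dim c' ≤ numLhsVars c' := by
  induction hcs with
  | nil => exact ⟨[], .nil, rfl, by simp⟩
  | @cons Y c Ys cs hc hcs ih =>
    simp only [List.mem_cons, forall_eq_or_imp] at hred
    obtain ⟨c', hc', hp, hd⟩ := hred.1 Y hc
    obtain ⟨cs', hcs', hps, hds⟩ := ih hred.2
    exact ⟨c' :: cs', .cons hc' hcs', by simp [hp, hps],
      by simpa using ⟨numLhsVars_congr hp ▸ hd, hds⟩⟩

theorem IsDTree.exists_dim_le [DecidableEq V] {G : CFG V A} {X : V} {t : RawTree V A}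
    (ht : IsDTree G X t) :
    ∃ t', IsDTree G X t' ∧ prods t' = prods t ∧ dim t' ≤ numLhsVars t := by
  induction hn : (prods t).card using Nat.strong_induction_on generalizing X t with
  | _ n ih =>
    subst hn
    obtain ⟨Z, rhs, cs⟩ := t
    by_cases hfull : ∃ s ∈ cs, lhsVars s = lhsVars (.node Z rhs cs)
    · obtain ⟨s, hs, hv⟩ := hfull
      obtain ⟨l, r, rfl⟩ := List.append_of_mem hs
      obtain ⟨l', s', r', ht', hp, hd, -⟩ :=
        exists_sink_of_reducible ht hv fun W u hu hlt => ih _ hlt hu rfl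
      exact ⟨_, ht', hp, hd.trans (numLhsVars_le_of_mem hs)⟩
    · push Not at hfull
      obtain ⟨rfl, hP, hch⟩ := isDTree_node_iff.1 ht
      obtain ⟨cs', hcs', hp, hd⟩ := exists_forall₂_of_reducible hch fun c hc W hW =>
        ih _ (card_prods_lt_of_mem hc) hW rfl
      refine ⟨.node X rhs cs', .node hP hcs', by rw [prods_node, prods_node, hp],
        dim_node_le_of_forall_lt fun c' hc' => (hd c' hc').trans_lt ?_⟩
      obtain ⟨c, hc, hcc'⟩ : ∃ c ∈ cs, prods c = prods c' := by
        simpa [hp] using List.mem_map_of_mem (f := prods) hc'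
      rw [← numLhsVars_congr hcc']
      exact Finset.card_lt_card ((lhsVars_subset_of_mem hc).ssubset_of_ne (hfull c hc))

theorem exists_forall₂_dim_le [DecidableEq V] {G : CFG V A} {Ys : List V}
    {cs : List (RawTree V A)} (hcs : List.Forall₂ (IsDTree G) Ys cs) :
    ∃ cs', List.Forall₂ (IsDTree G) Ys cs' ∧ cs'.map prods = cs.map prods ∧
      ∀ c' ∈ cs', dim c' ≤ numLhsVars c' :=
  exists_forall₂_of_reducible hcs fun _ _ _ h => h.exists_dim_le

theorem exists_forall₂_dim_le_of_numLhsVars_le [DecidableEq V] {G : CFG V A} {Ys : List V}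
    {cs : List (RawTree V A)} {n : ℕ} (hcs : List.Forall₂ (IsDTree G) Ys cs)
    (hn : ∀ c ∈ cs, numLhsVars c ≤ n) :
    ∃ cs', List.Forall₂ (IsDTree G) Ys cs' ∧ cs'.map prods = cs.map prods ∧
      ∀ c' ∈ cs', dim c' ≤ n := by
  obtain ⟨cs', hcs', hp, hd⟩ := exists_forall₂_dim_le hcs
  refine ⟨cs', hcs', hp, fun c' hc' => (hd c' hc').trans ?_⟩
  obtain ⟨c, hc, hcc'⟩ : ∃ c ∈ cs, prods c = prods c' := by
    simpa [hp] using List.mem_map_of_mem (f := prods) hc'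
  exact numLhsVars_congr hcc' ▸ hn c hc

/-- The derivation trees with root `X` and dimension at most `n` that use the same productions
as `t`, with multiplicity. -/
def rearrangements (G : CFG V A) (X : V) (t : RawTree V A) (n : ℕ) : Set (RawTree V A) :=
  {t' | IsDTree G X t' ∧ prods t' = prods t ∧ dim t' ≤ n}

theorem rearrangements_nontrivial_of_children [DecidableEq V] {G : CFG V A} {X Z : V}
    {rhs : List (A ⊕ V)} {cs : List (RawTree V A)} (ht : IsDTree G X (.node Z rhs cs))
    (hcs : ∀ c ∈ cs, dim c ≤ numLhsVars c)
    (hdim : numLhsVars (.node Z rhs cs) < dim (.node Z rhs cs)) :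
    (rearrangements G X (.node Z rhs cs) (numLhsVars (.node Z rhs cs))).Nontrivial := by
  have full : ∀ c ∈ cs, dim c = numLhsVars (.node Z rhs cs) →
      lhsVars c = lhsVars (.node Z rhs cs) := fun c hc hd =>
    Finset.eq_of_subset_of_card_le (lhsVars_subset_of_mem hc) (hd.symm.trans_le (hcs c hc))
  obtain ⟨l, a, m, b, r, rfl, ha, hb⟩ :=
    exists_two_of_lt_dim_node (fun c hc => (hcs c hc).trans (numLhsVars_le_of_mem hc)) hdim
  have hva := full a (by simp) ha
  have hvb := full b (by simp) hb
  have hna : numLhsVars a = numLhsVars (.node Z rhs (l ++ a :: (m ++ b :: r))) :=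
    congrArg Finset.card hva
  have hnb : numLhsVars b = numLhsVars (.node Z rhs (l ++ a :: (m ++ b :: r))) :=
    congrArg Finset.card hvb
  obtain ⟨l₁, a₁, r₁, ht₁, hp₁, hd₁, hl₁, -, hle₁⟩ :=
    exists_sink_of_reducible ht hva fun W u hu _ => hu.exists_dim_le
  have hassoc : l ++ a :: (m ++ b :: r) = (l ++ a :: m) ++ b :: r := by simp
  rw [hassoc] at ht hvb
  obtain ⟨l₂, b₂, r₂, ht₂, hp₂, hd₂, hl₂, -, -⟩ :=
    exists_sink_of_reducible ht hvb fun W u hu _ => hu.exists_dim_le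
  rw [← hassoc] at hp₂
  refine ⟨_, ⟨ht₁, hp₁, hna ▸ hd₁⟩, _, ⟨ht₂, hp₂, hnb ▸ hd₂⟩, fun heq => ?_⟩
  obtain ⟨l₃, a₃, r₃, hl₃, ha₃, rfl⟩ : ∃ l₃ a₃ r₃, l₃.length = l.length ∧
      (prods a₃).card < (prods a).card ∧ l₂ = l₃ ++ a₃ :: r₃ := by
    obtain ⟨l₃, a₃, r₃, h, hl, h', -⟩ := List.forall₂_append_cons_right_iff.1 hl₂.flip
    exact ⟨l₃, a₃, r₃, hl.length_eq, h' (hnb.trans ha.symm).le, h⟩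
  have hlists : l₁ ++ a₁ :: r₁ = l₃ ++ a₃ :: (r₃ ++ b₂ :: r₂) := by simpa using heq
  obtain ⟨-, h⟩ := List.append_inj hlists (hl₁.length_eq.symm.trans hl₃.symm)
  obtain rfl := (List.cons.inj h).1
  omega

theorem IsDTree.rearrangements_nontrivial [DecidableEq V] {G : CFG V A} {X : V} {t : RawTree V A}
    (ht : IsDTree G X t) (hdim : numLhsVars t < dim t) :
    (rearrangements G X t (numLhsVars t)).Nontrivial := by
  induction t using induction_children generalizing X with
  | node Z rhs cs ih =>
    have of_children : ∀ cs', IsDTree G X (.node Z rhs cs') →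
        prods (.node Z rhs cs') = prods (.node Z rhs cs) → (∀ c ∈ cs', dim c ≤ numLhsVars c) →
        (rearrangements G X (.node Z rhs cs) (numLhsVars (.node Z rhs cs))).Nontrivial ∨
          .node Z rhs cs' ∈
            rearrangements G X (.node Z rhs cs) (numLhsVars (.node Z rhs cs)) := by
      intro cs' ht' hp hcs'
      by_cases hd : dim (.node Z rhs cs') ≤ numLhsVars (.node Z rhs cs)
      · exact .inr ⟨ht', hp, hd⟩
      · left
        have h := rearrangements_nontrivial_of_children ht' hcs'
          (by rw [numLhsVars_congr hp]; omega)
        rwa [numLhsVars_congr hp, rearrangements, hp] at h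
    by_cases hcs : ∀ c ∈ cs, dim c ≤ numLhsVars c
    · exact rearrangements_nontrivial_of_children ht hcs hdim
    push Not at hcs
    obtain ⟨c, hc, hdc⟩ := hcs
    obtain ⟨rfl, hP, hch⟩ := isDTree_node_iff.1 ht
    obtain ⟨l, r, rfl⟩ := List.append_of_mem hc
    obtain ⟨x, W, y, hxy, hl, hcW, hr⟩ := List.forall₂_append_cons_right_iff.1 hch
    obtain ⟨c₁, ⟨hc₁, hp₁, hd₁⟩, c₂, ⟨hc₂, hp₂, hd₂⟩, hne⟩ := ih c hc hcW hdc
    obtain ⟨l', hl', hpl, hdl⟩ := exists_forall₂_dim_le hl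
    obtain ⟨r', hr', hpr, hdr⟩ := exists_forall₂_dim_le hr
    have key : ∀ c', IsDTree G W c' → prods c' = prods c → dim c' ≤ numLhsVars c →
        (rearrangements G X (.node X rhs (l ++ c :: r))
          (numLhsVars (.node X rhs (l ++ c :: r)))).Nontrivial ∨
        .node X rhs (l' ++ c' :: r') ∈ rearrangements G X (.node X rhs (l ++ c :: r))
          (numLhsVars (.node X rhs (l ++ c :: r))) := by
      intro c' hc' hp hd
      refine of_children _
        (.node hP (List.forall₂_append_cons_right_iff.2 ⟨x, W, y, hxy, hl', hc', hr'⟩)) ?_ ?_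
      · rw [prods_node_split, prods_node_split, hp, hpl, hpr]
      · simp only [List.mem_append, List.mem_cons]
        rintro d (hd' | rfl | hd')
        exacts [hdl d hd', numLhsVars_congr hp ▸ hd, hdr d hd']
    rcases key c₁ hc₁ hp₁ hd₁ with h | h₁
    · exact h
    rcases key c₂ hc₂ hp₂ hd₂ with h | h₂
    · exact h
    exact ⟨_, h₁, _, h₂, by simpa using hne⟩

theorem IsDTree.le_encard_rearrangements [DecidableEq V] {G : CFG V A} {X : V} {t : RawTree V A}
    {k : ℕ} (ht : IsDTree G X t) (hdim : numLhsVars t + k < dim t) :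
    (2 : ℕ∞) ^ (2 ^ k) ≤ (rearrangements G X t (numLhsVars t + k)).encard := by
  induction k generalizing X t with
  | zero =>
    obtain ⟨a, ha, b, hb, hab⟩ := ht.rearrangements_nontrivial hdim
    have : ({a, b} : Set (RawTree V A)).encard ≤ _ :=
      Set.encard_le_encard (Set.insert_subset ha (Set.singleton_subset_iff.2 hb))
    simpa [Set.encard_pair hab] using this
  | succ k ihk =>
    induction t using induction_children generalizing X with
    | node Z rhs cs ih =>
      obtain ⟨rfl, hP, hch⟩ := isDTree_node_iff.1 ht
      have hnum : ∀ c ∈ cs, numLhsVars c ≤ numLhsVars (.node X rhs cs) :=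
        fun c hc => numLhsVars_le_of_mem hc
      by_cases hcs : ∃ c ∈ cs, numLhsVars (.node X rhs cs) + (k + 1) < dim c
      · obtain ⟨c, hc, hdc⟩ := hcs
        obtain ⟨l, r, rfl⟩ := List.append_of_mem hc
        have hnc := hnum c hc
        obtain ⟨x, W, y, hxy, hl, hcW, hr⟩ := List.forall₂_append_cons_right_iff.1 hch
        obtain ⟨l', hl', hpl, hdl⟩ :=
          exists_forall₂_dim_le_of_numLhsVars_le hl fun d hd => hnum d (by simp [hd])
        obtain ⟨r', hr', hpr, hdr⟩ :=
          exists_forall₂_dim_le_of_numLhsVars_le hr fun d hd => hnum d (by simp [hd])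
        refine (ih c hc hcW (by omega)).trans
          (Set.encard_le_encard_of_injOn (f := fun c' => .node X rhs (l' ++ c' :: r')) ?_ ?_)
        · rintro c' ⟨hc', hp, hd⟩
          refine ⟨.node hP (List.forall₂_append_cons_right_iff.2 ⟨x, W, y, hxy, hl', hc', hr'⟩),
            ?_, ?_⟩
          · rw [prods_node_split, prods_node_split, hp, hpl, hpr]
          · refine dim_node_le_of_split (fun d hd => ?_) (fun d hd => ?_) (by omega)
            · have := hdl d hd; omega
            · have := hdr d hd; omega
        · intro c₁ _ c₂ _ h
          simpa using h
      · push Not at hcs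
        have hcs' : ∀ c ∈ cs, dim c ≤ dim (.node X rhs cs) - 1 := fun c hc => by
          have := hcs c hc; omega
        obtain ⟨l, a, m, b, r, rfl, ha, hb⟩ := exists_two_of_lt_dim_node hcs hdim
        obtain ⟨x, W, y, hxy, hl, haW, hmr⟩ := List.forall₂_append_cons_right_iff.1 hch
        obtain ⟨z, U, w, rfl, hm, hbU, hr⟩ := List.forall₂_append_cons_right_iff.1 hmr
        have hna := hnum a (by simp)
        have hnb := hnum b (by simp)
        obtain ⟨l', hl', hpl, hdl⟩ :=
          exists_forall₂_dim_le_of_numLhsVars_le hl fun d hd => hnum d (by simp [hd])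
        obtain ⟨m', hm', hpm, hdm⟩ :=
          exists_forall₂_dim_le_of_numLhsVars_le hm fun d hd => hnum d (by simp [hd])
        obtain ⟨r', hr', hpr, hdr⟩ :=
          exists_forall₂_dim_le_of_numLhsVars_le hr fun d hd => hnum d (by simp [hd])
        rw [pow_succ 2 k, mul_two, pow_add]
        refine (mul_le_mul' (ihk haW (by omega)) (ihk hbU (by omega))).trans ?_
        rw [← Set.encard_prod]
        refine Set.encard_le_encard_of_injOn
          (f := fun p => .node X rhs (l' ++ p.1 :: (m' ++ p.2 :: r'))) ?_ ?_
        · rintro ⟨a', b'⟩ ⟨⟨ha', hpa, hda⟩, hb', hpb, hdb⟩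
          refine ⟨.node hP (List.forall₂_append_cons_right_iff.2 ⟨x, W, _, hxy, hl', ha',
            List.forall₂_append_cons_right_iff.2 ⟨z, U, w, rfl, hm', hb', hr'⟩⟩), ?_, ?_⟩
          · simp only [prods_node, List.map_append, List.map_cons, hpl, hpm, hpr, hpa, hpb]
          · refine dim_node_le_of_forall_lt fun d hd => ?_
            simp only [List.mem_append, List.mem_cons] at hd
            dsimp only at hda hdb
            rcases hd with hd | rfl | hd | rfl | hd
            · have := hdl d hd; omega
            · omega
            · have := hdm d hd; omega
            · omega
            · have := hdr d hd; omega
        · rintro ⟨a₁, b₁⟩ _ ⟨a₂, b₂⟩ _ h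
          simpa using h

end RawTree

/-- If a `(G,X)`-derivation tree `t` has `dim(t) ≥ l(t) + k + 1`, then there are at
least `2^(2^k)` pairwise distinct Parikh-equivalent `(G,X)`-derivation trees of
dimension at most `l(t) + k`. -/
theorem many_parikh_equiv_trees {V A : Type} [Fintype V] [Fintype A]
    [DecidableEq V] (G : CFG V A) (hGfin : G.P.Finite)
    (X : V) (k : ℕ) (t : RawTree V A) (ht : IsDTree G X t)
    (hdim : numLhsVars t + k + 1 ≤ dim t) :
    ((2 : ℕ∞) ^ (2 ^ k)) ≤
      Set.encard {t' : RawTree V A | IsDTree G X t' ∧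
        parikh (yield t') = parikh (yield t) ∧ dim t' ≤ numLhsVars t + k} := by
  refine (ht.le_encard_rearrangements (by omega)).trans (Set.encard_le_encard ?_)
  rintro t' ⟨ht', hp, hd⟩
  exact ⟨ht', by rw [parikh_yield ht', parikh_yield ht, hp], hd⟩
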